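/- Let D be a k-arc-connected finite digraph and let P be a directed path from a vertex u to a vertex v in D. Then the digraph D^P obtained by reversing P is k-arc-connected if and only if λ_D(u,v) ≥ k + 1. In particular, whether D^P is k-arc-connected does not depend on the choice of the directed path P from u to v. -/

import Mathlib

section Defs

variable {V A E : Type*}

/-- A directed walk in the digraph given by `src`/`tgt`, from `u` to `v`,
recorded as its list of arcs. -/
def IsDiwalk (src tgt : A → V) : V → V → List A → Prop
  | u, v, [] => u = v
  | u, v, a :: p => src a = u ∧ IsDiwalk src tgt (tgt a) v p

/-- A directed path from `u` to `v`: a directed walk whose vertices are pairwise distinct. -/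
def IsDipath (src tgt : A → V) (u v : V) (p : List A) : Prop :=
  IsDiwalk src tgt u v p ∧ (u :: p.map tgt).Nodup

/-- A directed cycle: a nonempty closed directed walk whose vertices are pairwise distinct. -/
def IsDicycle (src tgt : A → V) (p : List A) : Prop :=
  p ≠ [] ∧ ∃ u, IsDiwalk src tgt u u p ∧ (p.map tgt).Nodup

/-- Source map of the digraph obtained by reversing the arcs in `B`. -/
noncomputable def rsrc (src tgt : A → V) (B : Set A) (a : A) : V :=
  haveI := Classical.propDecidable (a ∈ B)
  if a ∈ B then tgt a else src a

/-- Target map of the digraph obtained by reversing the arcs in `B`. -/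
noncomputable def rtgt (src tgt : A → V) (B : Set A) (a : A) : V :=
  haveI := Classical.propDecidable (a ∈ B)
  if a ∈ B then src a else tgt a

/-- The outdegree `δ⁺(X)` of a set of vertices: the number of arcs leaving `X`. -/
noncomputable def outdegS (src tgt : A → V) (X : Set V) : ℕ :=
  Nat.card {a : A // src a ∈ X ∧ tgt a ∉ X}

/-- The outdegree `δ⁺(v)` of a vertex: the number of arcs with source `v`. -/
noncomputable def outdegV (src tgt : A → V) (v : V) : ℕ :=
  Nat.card {a : A // src a = v}

/-- A digraph is `k`-arc-connected if every nonempty proper vertex subset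
has outdegree at least `k`. -/
def IsKConnected (src tgt : A → V) (k : ℕ) : Prop :=
  ∀ X : Set V, X.Nonempty → X ≠ Set.univ → k ≤ outdegS src tgt X

/-- `λ(u,v)`: the maximum number of pairwise arc-disjoint directed paths from `u` to `v`
(with value `⊤` when this is unbounded, e.g. for `u = v`). -/
noncomputable def lambdaConn (src tgt : A → V) (u v : V) : ℕ∞ :=
  sSup ((fun m : ℕ => (m : ℕ∞)) '' {m : ℕ | ∃ Ps : Fin m → List A,
    (∀ i, IsDipath src tgt u v (Ps i)) ∧
    Pairwise fun i j => (Ps i).Disjoint (Ps j)})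

/-- An orientation of the multigraph on vertex set `V` with edge set `E` and
endpoint map `ends : E → Sym2 V`. -/
structure GraphOrientation (V : Type*) (E : Type*) (ends : E → Sym2 V) where
  src : E → V
  tgt : E → V
  compat : ∀ e, s(src e, tgt e) = ends e

/-- The orientation obtained from `D` by reversing the arcs in `B`. -/
noncomputable def GraphOrientation.rev {ends : E → Sym2 V} (D : GraphOrientation V E ends) (B : Set E) :
    GraphOrientation V E ends where
  src := rsrc D.src D.tgt B
  tgt := rtgt D.src D.tgt B
  compat := by
    intro e
    unfold rsrc rtgt
    split
    · rw [Sym2.eq_swap]; exact D.compat e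
    · exact D.compat e

end Defs

open Classical in
/-- Indicator of a vertex set. -/
noncomputable def ind {V : Type*} (X : Set V) (w : V) : ℤ := if w ∈ X then 1 else 0

theorem diwalk_append {V A : Type*} (src tgt : A → V) (p q : List A) : ∀ (u v w : V),
    IsDiwalk src tgt u v p → IsDiwalk src tgt v w q → IsDiwalk src tgt u w (p ++ q) := by
  induction p with
  | nil => intro u v w h1 h2; cases h1; exact h2
  | cons a p ih => intro u v w h1 h2; exact ⟨h1.1, ih _ _ _ h1.2 h2⟩

theorem diwalk_split {V A : Type*} (src tgt : A → V) (p : List A) (a : A) (q : List A) :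
    ∀ (u w : V), IsDiwalk src tgt u w (p ++ a :: q) →
      IsDiwalk src tgt u (tgt a) (p ++ [a]) := by
  induction p with
  | nil => intro u w h; exact ⟨h.1, rfl⟩
  | cons b p ih => intro u w h; exact ⟨h.1, ih _ _ h.2⟩

theorem dipath_prefix {V A : Type*} (src tgt : A → V) (u w x : V) (p : List A)
    (hp : IsDipath src tgt u w p) (hx : x ∈ u :: p.map tgt) :
    ∃ q, IsDipath src tgt u x q ∧ ∀ a ∈ q, a ∈ p := by
  rcases List.mem_cons.1 hx with rfl | hx
  · exact ⟨[], ⟨rfl, by simp⟩, by simp⟩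
  · obtain ⟨a, ha, rfl⟩ := List.mem_map.1 hx
    obtain ⟨p1, p2, rfl⟩ := List.append_of_mem ha
    refine ⟨p1 ++ [a], ⟨diwalk_split _ _ _ _ _ _ _ hp.1, ?_⟩, ?_⟩
    · refine List.Nodup.sublist ?_ hp.2
      refine List.Sublist.cons_cons _ (List.Sublist.map _ ?_)
      simp
    · intro b hb
      simp at hb ⊢
      tauto

/-- If every `u`-`v` cut is left by an arc of `F`, there is a dipath inside `F`. -/
theorem exists_dipath {V A : Type*} (src tgt : A → V) (u v : V) (F : Set A)
    (h : ∀ X : Set V, u ∈ X → v ∉ X → ∃ a ∈ F, src a ∈ X ∧ tgt a ∉ X) :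
    ∃ p, IsDipath src tgt u v p ∧ ∀ a ∈ p, a ∈ F := by
  by_contra hv
  obtain ⟨a, haF, ⟨p, hp, hpF⟩, hta⟩ :=
    h {w | ∃ p, IsDipath src tgt u w p ∧ ∀ a ∈ p, a ∈ F}
      ⟨[], ⟨rfl, by simp⟩, by simp⟩ hv
  apply hta
  by_cases hx : tgt a ∈ u :: p.map tgt
  · obtain ⟨q, hq, hqp⟩ := dipath_prefix src tgt u _ _ p hp hx
    exact ⟨q, hq, fun b hb => hpF b (hqp b hb)⟩
  · refine ⟨p ++ [a], ⟨diwalk_append _ _ _ _ _ _ _ hp.1 ⟨rfl, rfl⟩, ?_⟩, ?_⟩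
    · have h2 : (u :: (p ++ [a]).map tgt) = (u :: p.map tgt) ++ [tgt a] := by simp
      rw [h2]
      refine List.Nodup.append hp.2 (by simp) ?_
      intro y hy hy'
      rw [List.mem_singleton] at hy'
      exact hx (hy' ▸ hy)
    · intro b hb
      rcases List.mem_append.1 hb with hb | hb
      · exact hpF b hb
      · rw [List.mem_singleton] at hb
        exact hb ▸ haF

/-- Net number of arcs of `F` leaving `X`. -/
noncomputable def netc {V A : Type*} (src tgt : A → V) (F : Finset A) (X : Set V) : ℤ :=
  ∑ a ∈ F, (ind X (src a) - ind X (tgt a))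

theorem walk_sum {V A : Type*} (src tgt : A → V) (X : Set V) (p : List A) : ∀ (u v : V),
    IsDiwalk src tgt u v p →
    (p.map (fun a => ind X (src a) - ind X (tgt a))).sum = ind X u - ind X v := by
  induction p with
  | nil => intro u v h; cases h; simp
  | cons a p ih =>
    intro u v h
    simp only [List.map_cons, List.sum_cons, ih _ _ h.2, h.1]
    ring

theorem netc_path {V A : Type*} [DecidableEq A] (src tgt : A → V) (X : Set V) (p : List A)
    (u v : V) (hp : IsDipath src tgt u v p) :
    netc src tgt p.toFinset X = ind X u - ind X v := by
  unfold netc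
  have hn : p.Nodup := List.Nodup.of_map _ (List.nodup_cons.1 hp.2).2
  rw [List.sum_toFinset _ hn, walk_sum _ _ _ _ _ _ hp.1]

theorem outdeg_sum {V A : Type*} [Fintype A] (src tgt : A → V) (X : Set V) :
    (outdegS src tgt X : ℤ) = ∑ a, ind X (src a) * (1 - ind X (tgt a)) := by
  classical
  unfold outdegS
  rw [Nat.card_eq_fintype_card, Fintype.card_subtype, Finset.card_filter]
  push_cast
  refine Finset.sum_congr rfl fun a _ => ?_
  unfold ind
  by_cases h1 : src a ∈ X <;> by_cases h2 : tgt a ∈ X <;> simp [h1, h2]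

theorem outdeg_rev {V A : Type*} [Fintype A] (src tgt : A → V) (X : Set V)
    (p : List A) (u v : V) (hp : IsDipath src tgt u v p) :
    (outdegS (rsrc src tgt {a | a ∈ p}) (rtgt src tgt {a | a ∈ p}) X : ℤ)
      = outdegS src tgt X - (ind X u - ind X v) := by
  classical
  rw [← netc_path src tgt X p u v hp, outdeg_sum, outdeg_sum, netc,
    ← Finset.sum_filter_add_sum_filter_not Finset.univ (fun a => a ∈ p.toFinset),
    ← Finset.sum_filter_add_sum_filter_not Finset.univ (fun a => a ∈ p.toFinset)
      (fun a => ind X (src a) * (1 - ind X (tgt a)))]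
  have e : Finset.univ.filter (fun a => a ∈ p.toFinset) = p.toFinset := by ext; simp
  rw [e, add_sub_right_comm, ← Finset.sum_sub_distrib]
  congr 1
  · refine Finset.sum_congr rfl fun a ha => ?_
    have ha' : a ∈ p := by simpa using ha
    simp only [rsrc, rtgt, Set.mem_ofPred_eq, ha', if_true]
    ring
  · refine Finset.sum_congr rfl fun a ha => ?_
    have ha' : a ∉ p := by simpa using ha
    simp only [rsrc, rtgt, Set.mem_ofPred_eq, ha', if_false]

theorem netc_symm {V A : Type*} [Fintype A] [DecidableEq A] (src tgt : A → V) (X : Set V)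
    (p : List A) (F : Finset A) :
    netc src tgt (symmDiff F p.toFinset) X =
      netc (rsrc src tgt {a | a ∈ p}) (rtgt src tgt {a | a ∈ p}) F X
        + netc src tgt p.toFinset X := by
  unfold netc
  rw [← Finset.univ_inter (symmDiff F p.toFinset), ← Finset.univ_inter F,
    ← Finset.univ_inter p.toFinset]
  simp only [← Finset.sum_ite_mem]
  rw [← Finset.sum_add_distrib]
  refine Finset.sum_congr rfl fun a _ => ?_
  simp only [Finset.univ_inter, Finset.mem_symmDiff, List.mem_toFinset, rsrc, rtgt,
    Set.mem_ofPred_eq]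
  by_cases h1 : a ∈ F <;> by_cases h2 : a ∈ p <;> simp [h1, h2]

theorem exists_flow {V A : Type*} [Fintype A] (u v : V) (m : ℕ) : ∀ (src tgt : A → V),
    (∀ X : Set V, u ∈ X → v ∉ X → m ≤ outdegS src tgt X) →
    ∃ F : Finset A, ∀ X : Set V, u ∈ X → v ∉ X → netc src tgt F X = m := by
  classical
  induction m with
  | zero => intro src tgt _; exact ⟨∅, by simp [netc]⟩
  | succ m ih =>
    intro src tgt h
    obtain ⟨p, hp, -⟩ := exists_dipath src tgt u v Set.univ (by
      intro X hu hv
      have h1 := h X hu hv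
      have h2 : 0 < outdegS src tgt X := by omega
      obtain ⟨⟨a, ha⟩⟩ := (Nat.card_pos_iff.1 h2).1
      exact ⟨a, trivial, ha⟩)
    obtain ⟨F, hF⟩ := ih (rsrc src tgt {a | a ∈ p}) (rtgt src tgt {a | a ∈ p}) (by
      intro X hu hv
      have h1 := h X hu hv
      have h2 := outdeg_rev src tgt X p u v hp
      simp only [ind, hu, hv, if_true, if_false] at h2
      omega)
    refine ⟨symmDiff F p.toFinset, fun X hu hv => ?_⟩
    rw [netc_symm, hF X hu hv, netc_path src tgt X p u v hp]
    simp [ind, hu, hv]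

theorem flow_decomp {V A : Type*} (src tgt : A → V) (u v : V) (m : ℕ) :
    ∀ F : Finset A, (∀ X : Set V, u ∈ X → v ∉ X → netc src tgt F X = m) →
    ∃ Ps : Fin m → List A, (∀ i, IsDipath src tgt u v (Ps i)) ∧
      (∀ i, ∀ a ∈ Ps i, a ∈ F) ∧ Pairwise fun i j => (Ps i).Disjoint (Ps j) := by
  classical
  induction m with
  | zero => intro F _; exact ⟨fun _ => [], fun i => i.elim0, fun i => i.elim0, fun i => i.elim0⟩
  | succ m ih =>
    intro F h
    obtain ⟨p, hp, hpF⟩ := exists_dipath src tgt u v (F : Set A) (by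
      intro X hu hv
      by_contra hc
      push Not at hc
      have h1 := h X hu hv
      have h2 : netc src tgt F X ≤ 0 := by
        refine Finset.sum_nonpos fun a ha => ?_
        have := hc a ha
        unfold ind
        by_cases h1 : src a ∈ X <;> by_cases h2 : tgt a ∈ X <;> simp_all
      push_cast at h1
      omega)
    have hsub : p.toFinset ⊆ F := fun a ha => by
      have := hpF a (List.mem_toFinset.1 ha)
      simpa using this
    obtain ⟨Ps, h1, h2, h3⟩ := ih (F \ p.toFinset) (by
      intro X hu hv
      have e : netc src tgt (F \ p.toFinset) X + netc src tgt p.toFinset X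
          = netc src tgt F X := Finset.sum_sdiff hsub
      rw [h X hu hv, netc_path src tgt X p u v hp] at e
      simp [ind, hu, hv] at e
      exact e)
    have hd : ∀ i, (Ps i).Disjoint p := fun i a ha hap => by
      have := h2 i a ha
      simp [hap] at this
    refine ⟨Fin.cons p Ps, ?_, ?_, ?_⟩
    · intro i
      refine Fin.cases ?_ (fun i => ?_) i
      · simpa using hp
      · simpa using h1 i
    · intro i
      refine Fin.cases ?_ (fun i => ?_) i
      · simpa using hpF
      · intro a ha
        rw [Fin.cons_succ] at ha
        exact (Finset.mem_sdiff.1 (h2 i a ha)).1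
    · intro i j
      refine Fin.cases ?_ (fun i => ?_) i <;> refine Fin.cases ?_ (fun j => ?_) j
      · intro hij; exact absurd rfl hij
      · intro _; simpa using (hd j).symm
      · intro _; simpa using hd i
      · intro hij
        simpa using h3 (fun e => hij (by rw [e]))

theorem walk_leaves {V A : Type*} (src tgt : A → V) (X : Set V) (p : List A) : ∀ (u v : V),
    IsDiwalk src tgt u v p → u ∈ X → v ∉ X → ∃ a ∈ p, src a ∈ X ∧ tgt a ∉ X := by
  induction p with
  | nil => intro u v h hu hv; cases h; exact absurd hu hv
  | cons a p ih =>
    intro u v h hu hv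
    by_cases ht : tgt a ∈ X
    · obtain ⟨b, hb, hb'⟩ := ih _ _ h.2 ht hv
      exact ⟨b, List.mem_cons_of_mem _ hb, hb'⟩
    · exact ⟨a, List.mem_cons_self, h.1 ▸ hu, ht⟩

theorem cut_ge {V A : Type*} [Fintype A] (src tgt : A → V) (u v : V) (m : ℕ)
    (Ps : Fin m → List A) (h1 : ∀ i, IsDipath src tgt u v (Ps i))
    (h2 : Pairwise fun i j => (Ps i).Disjoint (Ps j)) (X : Set V) (hu : u ∈ X) (hv : v ∉ X) :
    m ≤ outdegS src tgt X := by
  choose f hf hf' using fun i => walk_leaves src tgt X (Ps i) u v (h1 i).1 hu hv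
  have := Nat.card_le_card_of_injective
    (fun i => (⟨f i, hf' i⟩ : {a : A // src a ∈ X ∧ tgt a ∉ X})) (by
      intro i j hij
      by_contra hne
      have e : f i = f j := congrArg Subtype.val hij
      exact h2 hne (hf i) (e ▸ hf j))
  simpa [outdegS] using this

/-- For a `k`-arc-connected digraph `D` and a directed path `P` from
`u` to `v`, the digraph `D^P` is `k`-arc-connected iff `λ_D(u,v) ≥ k + 1`. -/
theorem stmt_7 {V A : Type*} [Fintype V] [Fintype A]
    (src tgt : A → V) (hloop : ∀ a, src a ≠ tgt a) (k : ℕ)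
    (hD : IsKConnected src tgt k)
    (u v : V) (p : List A) (hp : IsDipath src tgt u v p) :
    IsKConnected (rsrc src tgt {a | a ∈ p}) (rtgt src tgt {a | a ∈ p}) k ↔
      (k : ℕ∞) + 1 ≤ lambdaConn src tgt u v := by
  constructor
  · intro h
    obtain ⟨F, hF⟩ := exists_flow u v (k + 1) src tgt (by
      intro X hu hv
      have h1 := h X ⟨u, hu⟩ (fun e => hv (e ▸ Set.mem_univ v))
      have h2 := outdeg_rev src tgt X p u v hp
      simp only [ind, hu, hv, if_true, if_false] at h2
      omega)
    obtain ⟨Ps, h1, -, h3⟩ := flow_decomp src tgt u v (k + 1) F hF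
    exact le_sSup ⟨k + 1, ⟨Ps, h1, h3⟩, by push_cast; rfl⟩
  · intro h X hX hX'
    have h2 := outdeg_rev src tgt X p u v hp
    have h0 := hD X hX hX'
    by_cases hu : u ∈ X <;> by_cases hv : v ∈ X <;>
      simp only [ind, hu, hv, if_true, if_false] at h2
    · omega
    · have h3 : (k : ℕ∞) < lambdaConn src tgt u v :=
        lt_of_lt_of_le (by exact_mod_cast Nat.lt_succ_self k) h
      obtain ⟨_, ⟨m, ⟨Ps, hP1, hP2⟩, rfl⟩, hm⟩ := lt_sSup_iff.1 h3
      have hm2 : k < m := Nat.cast_lt.1 hm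
      have := cut_ge src tgt u v m Ps hP1 hP2 X hu hv
      omega
    · omega
    · omega
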